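/- Suppose G : ℝ × ℝ → P(ℝ) satisfies the structural assumptions (S1) and (S2), and that the differential inclusion v̇ ∈ G(t,v) admits exactly one T-periodic solution v*. Then v* is a global attractor: every solution v of the inclusion on an interval [t₀, ∞) satisfies lim_{t→+∞} (v(t) − v*(t)) = 0. -/

import Mathlib

open MeasureTheory Set Filter Topology

/-- A set-valued map `F : ℝ → P(ℝ)` is monotone increasing. -/
def SVMonoInc (F : ℝ → Set ℝ) : Prop :=
  ∀ ⦃u₁ u₂ y₁ y₂ : ℝ⦄, y₁ ∈ F u₁ → y₂ ∈ F u₂ → u₁ ≠ u₂ → 0 ≤ (y₂ - y₁) * (u₂ - u₁)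

/-- A set-valued map `F : ℝ → P(ℝ)` is maximal monotone increasing:
it is monotone increasing and its graph is maximal among graphs of
monotone increasing set-valued maps. -/
def SVMaxMonoInc (F : ℝ → Set ℝ) : Prop :=
  SVMonoInc F ∧ ∀ F' : ℝ → Set ℝ, SVMonoInc F' → (∀ u, F u ⊆ F' u) → ∀ u, F' u ⊆ F u

/-- Structural assumption (S1): `G(t,u) = -A(t,u) + p(t,u)` where `A` is nonempty-valued,
`T`-periodic in `t`, measurable in `t`, locally bounded by a measurable function and
maximal monotone increasing in `u`; and `p` is a single-valued Carathéodory function,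
`T`-periodic in `t` and locally Lipschitz in `u` uniformly in `t`. -/
def SatS1 (T : ℝ) (G : ℝ → ℝ → Set ℝ) : Prop :=
  ∃ (A : ℝ → ℝ → Set ℝ) (p : ℝ → ℝ → ℝ),
    (∀ t u, G t u = {x | ∃ y ∈ A t u, x = -y + p t u}) ∧
    (∀ t u, (A t u).Nonempty) ∧
    (∀ u, Function.Periodic (fun t => A t u) T) ∧
    (∀ u, MeasurableSet {q : ℝ × ℝ | q.2 ∈ A q.1 u}) ∧
    (∀ r : ℝ, 0 < r → ∃ m : ℝ → ℝ, Measurable m ∧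
      ∀ t u y, |u| ≤ r → y ∈ A t u → |y| ≤ m t) ∧
    (∀ t, SVMaxMonoInc (A t)) ∧
    (∀ u, Measurable fun t => p t u) ∧
    (∀ t, Continuous fun u => p t u) ∧
    (∀ u, Function.Periodic (fun t => p t u) T) ∧
    (∀ r : ℝ, 0 < r → ∃ L : ℝ, ∀ t u₁ u₂, |u₁| ≤ r → |u₂| ≤ r →
      |p t u₁ - p t u₂| ≤ L * |u₁ - u₂|)

/-- Structural assumption (S2), with explicit data `R`, `ℓm = ℓ_d^-`, `ℓp = ℓ_d^+`. -/
def S2Data (T : ℝ) (G : ℝ → ℝ → Set ℝ) (R : ℝ) (ℓm ℓp : ℝ → ℝ) : Prop :=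
  0 < R ∧ Measurable ℓm ∧ Measurable ℓp ∧
    Function.Periodic ℓm T ∧ Function.Periodic ℓp T ∧
    (∫ s in (0:ℝ)..T, ℓm s) < 0 ∧ (∫ s in (0:ℝ)..T, ℓp s) < 0 ∧
    (∀ᵐ t ∂(volume : Measure ℝ), ∀ u ≤ -R, ∀ y ∈ G t u, -ℓm t ≤ y) ∧
    (∀ᵐ t ∂(volume : Measure ℝ), ∀ u, R ≤ u → ∀ y ∈ G t u, y ≤ ℓp t)

/-- Structural assumption (S2). -/
def SatS2 (T : ℝ) (G : ℝ → ℝ → Set ℝ) : Prop :=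
  ∃ R ℓm ℓp, S2Data T G R ℓm ℓp

/-- `v` is a solution of the differential inclusion `v̇ ∈ G(t,v)` on the interval `I`:
`v` is locally absolutely continuous on `I` (primitive of a locally integrable `g`)
and its a.e. derivative `g` satisfies `g t ∈ G t (v t)` for a.e. `t ∈ I`. -/
def IsSolOn (G : ℝ → ℝ → Set ℝ) (v : ℝ → ℝ) (I : Set ℝ) : Prop :=
  ∃ g : ℝ → ℝ,
    (∀ a ∈ I, ∀ b ∈ I, a ≤ b →
      IntervalIntegrable g volume a b ∧ v b - v a = ∫ s in a..b, g s) ∧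
    (∀ᵐ t ∂(volume : Measure ℝ), t ∈ I → g t ∈ G t (v t))

/-- The regularity properties of the right-hand side that are used below. -/
structure OneSidedRegular (T : ℝ) (G : ℝ → ℝ → Set ℝ) : Prop where
  periodic : ∀ t u, G (t + T) u = G t u
  oneSided : ∀ r : ℝ, 0 < r → ∃ L : ℝ, 0 ≤ L ∧ ∀ t u₁ u₂ y₁ y₂, |u₁| ≤ r → |u₂| ≤ r → u₁ < u₂ →
    y₁ ∈ G t u₁ → y₂ ∈ G t u₂ → y₂ - y₁ ≤ L * (u₂ - u₁)
  bounded : ∀ r : ℝ, 0 < r → ∀ t, ∃ M : ℝ, ∀ u y, |u| ≤ r → y ∈ G t u → |y| ≤ M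
  closed : ∀ t (u y : ℕ → ℝ) (u' y' : ℝ), Tendsto u atTop (𝓝 u') → Tendsto y atTop (𝓝 y') →
    (∀ n, y n ∈ G t (u n)) → y' ∈ G t u'

/-- The graph of a maximal monotone map is sequentially closed. -/
theorem SVMaxMonoInc.mem_of_tendsto {F : ℝ → Set ℝ} (hF : SVMaxMonoInc F) {u y : ℕ → ℝ}
    {u' y' : ℝ} (hu : Tendsto u atTop (𝓝 u')) (hy : Tendsto y atTop (𝓝 y'))
    (h : ∀ n, y n ∈ F (u n)) : y' ∈ F u' := by
  have key : ∀ w z, z ∈ F w → 0 ≤ (y' - z) * (u' - w) := by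
    intro w z hz
    refine ge_of_tendsto' ((hy.sub_const z).mul (hu.sub_const w)) fun n => ?_
    by_cases hw : w = u n
    · simp [hw]
    · exact hF.1 hz (h n) hw
  have hmono : SVMonoInc fun x => {z | z ∈ F x ∨ (x = u' ∧ z = y')} := by
    rintro u₁ u₂ y₁ y₂ (h₁ | ⟨rfl, rfl⟩) (h₂ | ⟨rfl, rfl⟩) hne
    · exact hF.1 h₁ h₂ hne
    · exact key _ _ h₁
    · have := key _ _ h₂
      linarith
    · exact absurd rfl hne
  exact hF.2 _ hmono (fun x z hz => Or.inl hz) u' (Or.inr ⟨rfl, rfl⟩)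

theorem SatS1.oneSidedRegular {T : ℝ} {G : ℝ → ℝ → Set ℝ} (h : SatS1 T G) :
    OneSidedRegular T G := by
  obtain ⟨A, p, hG, -, hAper, -, hAbd, hAmax, -, hpc, hpper, hpL⟩ := h
  refine ⟨fun t u => ?_, fun r hr => ?_, fun r hr t => ?_, fun t u y u' y' hu hy hn => ?_⟩
  · have h1 : A (t + T) u = A t u := hAper u t
    have h2 : p (t + T) u = p t u := hpper u t
    rw [hG, hG, h1, h2]
  · obtain ⟨L, hL⟩ := hpL r hr
    refine ⟨|L|, abs_nonneg L, fun t u₁ u₂ y₁ y₂ h₁ h₂ hlt hy₁ hy₂ => ?_⟩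
    rw [hG] at hy₁ hy₂
    obtain ⟨a₁, ha₁, rfl⟩ := hy₁
    obtain ⟨a₂, ha₂, rfl⟩ := hy₂
    have hmono := (hAmax t).1 ha₁ ha₂ hlt.ne
    have ha : 0 ≤ a₂ - a₁ := nonneg_of_mul_nonneg_left hmono (sub_pos.2 hlt)
    have hp := hL t u₂ u₁ h₂ h₁
    rw [abs_of_pos (sub_pos.2 hlt)] at hp
    have h3 := le_abs_self (p t u₂ - p t u₁)
    have h4 := mul_le_mul_of_nonneg_right (le_abs_self L) (sub_pos.2 hlt).le
    linarith
  · obtain ⟨m, -, hm⟩ := hAbd r hr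
    obtain ⟨L, hL⟩ := hpL r hr
    refine ⟨m t + (|p t 0| + |L| * r), fun u y hu hy => ?_⟩
    rw [hG] at hy
    obtain ⟨a, ha, rfl⟩ := hy
    have h1 := hm t u a hu ha
    have h2 := hL t u 0 hu (by simpa using hr.le)
    rw [sub_zero] at h2
    have h3 : L * |u| ≤ |L| * r :=
      mul_le_mul (le_abs_self L) hu (abs_nonneg u) (abs_nonneg L)
    have h4 := abs_sub_abs_le_abs_sub (p t u) (p t 0)
    have h5 := abs_add_le (-a) (p t u)
    rw [abs_neg] at h5
    linarith
  · simp only [hG, mem_ofPred_eq] at hn ⊢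
    choose a ha hya using hn
    refine ⟨p t u' - y', (hAmax t).mem_of_tendsto hu ?_ ha, by ring⟩
    have : a = fun n => p t (u n) - y n := by
      funext n
      rw [hya n]
      ring
    rw [this]
    exact (((hpc t).tendsto u').comp hu).sub hy

/-- Reflection of a set-valued map through the origin of the state space. -/
def reflectRHS (G : ℝ → ℝ → Set ℝ) : ℝ → ℝ → Set ℝ := fun t u => {y | -y ∈ G t (-u)}

theorem OneSidedRegular.reflect {T : ℝ} {G : ℝ → ℝ → Set ℝ} (h : OneSidedRegular T G) :
    OneSidedRegular T (reflectRHS G) := by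
  refine ⟨fun t u => ?_, fun r hr => ?_, fun r hr t => ?_, fun t u y u' y' hu hy hn => ?_⟩
  · simp only [reflectRHS, h.periodic]
  · obtain ⟨L, hL0, hL⟩ := h.oneSided r hr
    refine ⟨L, hL0, fun t u₁ u₂ y₁ y₂ h₁ h₂ hlt hy₁ hy₂ => ?_⟩
    have := hL t (-u₂) (-u₁) (-y₂) (-y₁) (by simpa using h₂) (by simpa using h₁)
      (neg_lt_neg hlt) hy₂ hy₁
    linarith
  · obtain ⟨M, hM⟩ := h.bounded r hr t
    refine ⟨M, fun u y hu hy => ?_⟩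
    simpa using hM (-u) (-y) (by simpa using hu) hy
  · exact h.closed t (fun n => -u n) (fun n => -y n) (-u') (-y') hu.neg hy.neg hn

theorem IsSolOn.reflect {G : ℝ → ℝ → Set ℝ} {v : ℝ → ℝ} {I : Set ℝ} (h : IsSolOn G v I) :
    IsSolOn (reflectRHS G) (fun t => -v t) I := by
  obtain ⟨g, hg, hgG⟩ := h
  refine ⟨fun t => -g t, fun a ha b hb hab => ?_, ?_⟩
  · obtain ⟨h1, h2⟩ := hg a ha b hb hab
    refine ⟨h1.neg, ?_⟩
    rw [intervalIntegral.integral_neg, ← h2]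
    ring
  · filter_upwards [hgG] with t ht hI
    simpa [reflectRHS] using ht hI

theorem IsSolOn.mono {G : ℝ → ℝ → Set ℝ} {v : ℝ → ℝ} {I J : Set ℝ} (h : IsSolOn G v I)
    (hJ : J ⊆ I) : IsSolOn G v J := by
  obtain ⟨g, hg, hgG⟩ := h
  refine ⟨g, fun a ha b hb hab => hg a (hJ ha) b (hJ hb) hab, ?_⟩
  filter_upwards [hgG] with t ht hI using ht (hJ hI)

theorem ae_comp_add_right {P : ℝ → Prop} (h : ∀ᵐ t, P t) (c : ℝ) : ∀ᵐ t, P (t + c) :=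
  (measurePreserving_add_right volume c).quasiMeasurePreserving.ae h

theorem IsSolOn.shift {G : ℝ → ℝ → Set ℝ} {v : ℝ → ℝ} {s T : ℝ} (hT : 0 < T)
    (hG : ∀ t u, G (t + T) u = G t u) (h : IsSolOn G v (Ici s)) :
    IsSolOn G (fun t => v (t + T)) (Ici s) := by
  obtain ⟨g, hg, hgG⟩ := h
  refine ⟨fun t => g (t + T), fun a ha b hb hab => ?_, ?_⟩
  · have ha' : s ≤ a := ha
    have hb' : s ≤ b := hb
    obtain ⟨h1, h2⟩ := hg (a + T) (mem_Ici.2 (by linarith)) (b + T) (mem_Ici.2 (by linarith))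
      (by linarith)
    refine ⟨by simpa using h1.comp_add_right T, ?_⟩
    rw [intervalIntegral.integral_comp_add_right, h2]
  · filter_upwards [ae_comp_add_right hgG T] with t ht hI
    have hI' : s ≤ t := hI
    rw [← hG]
    exact ht (mem_Ici.2 (by linarith))

theorem IsSolOn.continuousOn {G : ℝ → ℝ → Set ℝ} {v : ℝ → ℝ} {s : ℝ}
    (h : IsSolOn G v (Ici s)) : ContinuousOn v (Ici s) := by
  obtain ⟨g, hg, -⟩ := h
  intro t ht
  have ht' : s ≤ t := ht
  have hcont : ContinuousOn v (Icc s (t + 1)) := by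
    have hint := (hg s self_mem_Ici (t + 1) (mem_Ici.2 (by linarith)) (by linarith)).1
    have hc := intervalIntegral.continuousOn_primitive_interval' hint left_mem_uIcc
    rw [uIcc_of_le (by linarith)] at hc
    refine (continuousOn_const (c := v s) |>.add hc).congr fun x hx => ?_
    exact sub_eq_iff_eq_add'.1 (hg s self_mem_Ici x hx.1 hx.1).2
  refine (hcont t ⟨ht', by linarith⟩).mono_of_mem_nhdsWithin ?_
  rw [← Ici_inter_Iic]
  exact inter_mem_nhdsWithin _ (Iic_mem_nhds (by linarith))

theorem integral_le_of_ae_Ioo {f g : ℝ → ℝ} {a b : ℝ} (hab : a ≤ b)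
    (hf : IntervalIntegrable f volume a b) (hg : IntervalIntegrable g volume a b)
    (h : ∀ᵐ t, t ∈ Ioo a b → f t ≤ g t) : ∫ t in a..b, f t ≤ ∫ t in a..b, g t := by
  refine intervalIntegral.integral_mono_ae_restrict hab hf hg ?_
  rw [← Measure.restrict_congr_set Ioo_ae_eq_Icc]
  exact (ae_restrict_iff' measurableSet_Ioo).2 h

/-- The last time before `b` at which a continuous function is at most `c`. -/
theorem exists_last_le {f : ℝ → ℝ} {a b c : ℝ} (hab : a ≤ b) (hf : ContinuousOn f (Icc a b))
    (ha : f a ≤ c) (hb : c < f b) :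
    ∃ s, a ≤ s ∧ s < b ∧ f s ≤ c ∧ ∀ t ∈ Ioc s b, c < f t := by
  have hcl : IsCompact (Icc a b ∩ f ⁻¹' Iic c) :=
    isCompact_Icc.of_isClosed_subset (hf.preimage_isClosed_of_isClosed isClosed_Icc isClosed_Iic)
      inter_subset_left
  obtain ⟨s, hs, hmax⟩ := hcl.exists_isGreatest ⟨a, ⟨le_rfl, hab⟩, ha⟩
  have hsc : f s ≤ c := hs.2
  refine ⟨s, hs.1.1, lt_of_le_of_ne hs.1.2 ?_, hsc, fun t ht => ?_⟩
  · rintro rfl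
    linarith
  · by_contra! hle
    exact absurd (hmax ⟨⟨hs.1.1.trans ht.1.le, ht.2⟩, hle⟩) (not_le.2 ht.1)

/-- Order preservation of the forward flow. -/
theorem OneSidedRegular.le_of_le {T : ℝ} {G : ℝ → ℝ → Set ℝ} (hG : OneSidedRegular T G)
    {v₁ v₂ : ℝ → ℝ} {a r : ℝ} (hr : 0 < r) (h₁ : IsSolOn G v₁ (Ici a))
    (h₂ : IsSolOn G v₂ (Ici a)) (hb₁ : ∀ t, a ≤ t → |v₁ t| ≤ r) (hb₂ : ∀ t, a ≤ t → |v₂ t| ≤ r)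
    (hle : v₁ a ≤ v₂ a) {t : ℝ} (ht : a ≤ t) : v₁ t ≤ v₂ t := by
  by_contra! hlt
  obtain ⟨L, hL0, hL⟩ := hG.oneSided r hr
  have hc : ContinuousOn (fun x => v₁ x - v₂ x) (Ici a) := h₁.continuousOn.sub h₂.continuousOn
  obtain ⟨s, has, hst, hs, hpos⟩ := exists_last_le (f := fun x => v₁ x - v₂ x) (c := 0) ht
    (hc.mono Icc_subset_Ici_self) (sub_nonpos.2 hle) (sub_pos.2 hlt)
  obtain ⟨g₁, hg₁, hG₁⟩ := h₁
  obtain ⟨g₂, hg₂, hG₂⟩ := h₂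
  set b := min t (s + 1 / (L + 1))
  have hL1 : 0 < L + 1 := by linarith
  have hsb : s < b := lt_min hst (by have : 0 < 1 / (L + 1) := by positivity
                                     linarith)
  obtain ⟨x, hx, hmax⟩ := isCompact_Icc.exists_isMaxOn (nonempty_Icc.2 hsb.le)
    (hc.mono fun y (hy : y ∈ Icc s b) => mem_Ici.2 (has.trans hy.1))
  have hbpos : 0 < v₁ b - v₂ b := hpos b ⟨hsb, min_le_left _ _⟩
  have hM : v₁ b - v₂ b ≤ v₁ x - v₂ x := hmax (right_mem_Icc.2 hsb.le)
  have hsx : s ≤ x := hx.1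
  obtain ⟨i₁, e₁⟩ := hg₁ s has x (has.trans hsx) hsx
  obtain ⟨i₂, e₂⟩ := hg₂ s has x (has.trans hsx) hsx
  have hint : ∫ y in s..x, (g₁ y - g₂ y) ≤ ∫ _ in s..x, L * (v₁ x - v₂ x) := by
    refine integral_le_of_ae_Ioo hsx (i₁.sub i₂) intervalIntegrable_const ?_
    filter_upwards [hG₁, hG₂] with y hy₁ hy₂ hy
    have hay : a ≤ y := has.trans hy.1.le
    have hyb : y ≤ b := hy.2.le.trans hx.2
    have hyp : 0 < v₁ y - v₂ y := hpos y ⟨hy.1, hyb.trans (min_le_left _ _)⟩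
    have h3 := hL y (v₂ y) (v₁ y) (g₂ y) (g₁ y) (hb₂ y hay) (hb₁ y hay) (sub_pos.1 hyp)
      (hy₂ hay) (hy₁ hay)
    have h4 : v₁ y - v₂ y ≤ v₁ x - v₂ x := hmax ⟨hy.1.le, hyb⟩
    exact h3.trans (mul_le_mul_of_nonneg_left h4 hL0)
  rw [intervalIntegral.integral_sub i₁ i₂, ← e₁, ← e₂, intervalIntegral.integral_const,
    smul_eq_mul] at hint
  have hxs : x - s ≤ 1 / (L + 1) := by
    have := hx.2.trans (min_le_right t (s + 1 / (L + 1)))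
    linarith
  have h5 : (x - s) * (L + 1) ≤ 1 := by
    have := mul_le_mul_of_nonneg_right hxs hL1.le
    rwa [one_div, inv_mul_cancel₀ hL1.ne'] at this
  have hD : 0 < v₁ x - v₂ x := hbpos.trans_le hM
  have hxs' : 0 < x - s := by
    rcases hsx.eq_or_lt with h | h
    · rw [← h] at hD
      linarith
    · linarith
  nlinarith [mul_pos hxs' hD, mul_le_mul_of_nonneg_right h5 hD.le]

theorem periodic_integral_le {ℓ : ℝ → ℝ} {T : ℝ} (hT : 0 < T) (hper : Function.Periodic ℓ T)
    (hint : ∀ a b, IntervalIntegrable ℓ volume a b) (hneg : ∫ s in (0:ℝ)..T, ℓ s < 0)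
    {a b : ℝ} (hab : a ≤ b) : ∫ s in a..b, ℓ s ≤ ∫ s in (0:ℝ)..T, |ℓ s| := by
  have hperabs : Function.Periodic (fun s => |ℓ s|) T := fun t => by simp only [hper t]
  set n := toIcoDiv hT a b
  have hn : 0 ≤ n := by
    by_contra! h
    have h1 := sub_toIcoDiv_zsmul_mem_Ico hT a b
    have h2 : ((toIcoDiv hT a b : ℤ) : ℝ) ≤ -1 := by exact_mod_cast Int.le_sub_one_of_lt h
    rw [zsmul_eq_mul] at h1
    have := h1.2
    nlinarith
  have hmem := sub_toIcoDiv_zsmul_mem_Ico hT a b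
  have hsplit := intervalIntegral.integral_add_adjacent_intervals (hint a (a + n • T))
    (hint (a + n • T) b)
  rw [← hsplit, hper.intervalIntegral_add_zsmul_eq n a hint, hper.intervalIntegral_add_eq a 0,
    zero_add]
  have h1 : n • ∫ s in (0:ℝ)..T, ℓ s ≤ 0 := by
    rw [zsmul_eq_mul]
    exact mul_nonpos_of_nonneg_of_nonpos (by exact_mod_cast hn) hneg.le
  have hle : a + n • T ≤ b := by linarith [hmem.1]
  have h2 : ∫ s in (a + n • T)..b, ℓ s ≤ ∫ s in (a + n • T)..b, |ℓ s| :=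
    intervalIntegral.integral_mono_on hle (hint _ _) (hint _ _).abs fun x _ => le_abs_self _
  have h3 : ∫ s in (a + n • T)..b, |ℓ s| ≤ ∫ s in (a + n • T)..(a + n • T + T), |ℓ s| :=
    intervalIntegral.integral_mono_interval le_rfl hle (by linarith [hmem.2])
      (Eventually.of_forall fun x => abs_nonneg _) (hint _ _).abs
  rw [hperabs.intervalIntegral_add_eq (a + n • T) 0, zero_add] at h3
  linarith

theorem IsSolOn.exists_upper_bound {G : ℝ → ℝ → Set ℝ} {v ℓ : ℝ → ℝ} {T R t₀ : ℝ} (hT : 0 < T)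
    (hper : Function.Periodic ℓ T) (hneg : ∫ s in (0:ℝ)..T, ℓ s < 0)
    (hG : ∀ᵐ t ∂(volume : Measure ℝ), ∀ u, R ≤ u → ∀ y ∈ G t u, y ≤ ℓ t)
    (hv : IsSolOn G v (Ici t₀)) : ∃ M, ∀ t, t₀ ≤ t → v t ≤ M := by
  have hint : ∀ a b, IntervalIntegrable ℓ volume a b := by
    refine hper.intervalIntegrable₀ hT.ne' ?_
    by_contra h
    rw [intervalIntegral.integral_undef h] at hneg
    exact lt_irrefl _ hneg
  refine ⟨max R (v t₀) + ∫ s in (0:ℝ)..T, |ℓ s|, fun t ht => ?_⟩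
  rcases le_or_gt (v t) (max R (v t₀)) with h | h
  · have : 0 ≤ ∫ s in (0:ℝ)..T, |ℓ s| :=
      intervalIntegral.integral_nonneg hT.le fun x _ => abs_nonneg _
    linarith
  · obtain ⟨s, h0s, hst, hs, hgt⟩ := exists_last_le ht
      (hv.continuousOn.mono Icc_subset_Ici_self) (le_max_right R (v t₀)) h
    obtain ⟨g, hg, hgG⟩ := hv
    obtain ⟨i, e⟩ := hg s h0s t ht hst.le
    have h1 : ∫ x in s..t, g x ≤ ∫ x in s..t, ℓ x := by
      refine integral_le_of_ae_Ioo hst.le i (hint _ _) ?_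
      filter_upwards [hG, hgG] with x hx₁ hx₂ hx
      exact hx₁ (v x) ((le_max_left _ _).trans (hgt x ⟨hx.1, hx.2.le⟩).le) (g x)
        (hx₂ (h0s.trans hx.1.le))
    have h2 := periodic_integral_le hT hper hint hneg hst.le
    linarith

theorem IsSolOn.exists_abs_bound {G : ℝ → ℝ → Set ℝ} {v : ℝ → ℝ} {T t₀ : ℝ} (hT : 0 < T)
    (hG : SatS2 T G) (hv : IsSolOn G v (Ici t₀)) : ∃ r, 0 < r ∧ ∀ t, t₀ ≤ t → |v t| ≤ r := by
  obtain ⟨R, ℓm, ℓp, -, -, -, hmper, hpper, hmneg, hpneg, hm, hp⟩ := hG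
  obtain ⟨M, hM⟩ := hv.exists_upper_bound hT hpper hpneg hp
  have hm' : ∀ᵐ t ∂(volume : Measure ℝ), ∀ u, R ≤ u → ∀ y ∈ reflectRHS G t u, y ≤ ℓm t := by
    filter_upwards [hm] with t ht u hu y hy
    linarith [ht (-u) (neg_le_neg hu) (-y) hy]
  obtain ⟨N, hN⟩ := hv.reflect.exists_upper_bound hT hmper hmneg hm'
  refine ⟨|M| + |N| + 1, by positivity, fun t ht => ?_⟩
  have h1 := hM t ht
  have h2 := hN t ht
  rw [abs_le]
  constructor <;>
  linarith [le_abs_self M, le_abs_self N, abs_nonneg M, abs_nonneg N]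

theorem exists_add_nat_mul {T : ℝ} (hT : 0 < T) {s t : ℝ} (ht : s ≤ t) :
    ∃ x ∈ Ico s (s + T), ∃ n : ℕ, t = x + n * T := by
  refine ⟨t - ⌊(t - s) / T⌋₊ * T, ⟨?_, ?_⟩, ⌊(t - s) / T⌋₊, by ring⟩
  · have := Nat.floor_le (div_nonneg (sub_nonneg.2 ht) hT.le)
    rw [le_div_iff₀ hT] at this
    linarith
  · have := Nat.lt_floor_add_one ((t - s) / T)
    rw [div_lt_iff₀ hT] at this
    linarith

theorem eq_of_periodic_tail {w : ℝ → ℝ} {s T : ℝ} (hT : 0 < T)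
    (hw : ∀ t, s ≤ t → w (t + T) = w t) {t : ℝ} (ht : s ≤ t) (n : ℕ) : w (t + n * T) = w t := by
  induction n with
  | zero => simp
  | succ k ih =>
    have hk : (0 : ℝ) ≤ k * T := by positivity
    rw [← ih, ← hw (t + k * T) (by linarith)]
    congr 1
    push_cast
    ring

theorem rhs_add_nat_mul {G : ℝ → ℝ → Set ℝ} {T : ℝ} (hG : ∀ t u, G (t + T) u = G t u) (n : ℕ)
    (t u : ℝ) : G (t + n * T) u = G t u :=
  Function.Periodic.nat_mul (f := fun t => G t u) (fun t => hG t u) n t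

/-- A solution on a half-line that is periodic there extends to a periodic solution. -/
theorem IsSolOn.exists_periodic_extension {G : ℝ → ℝ → Set ℝ} {w : ℝ → ℝ} {s T : ℝ} (hT : 0 < T)
    (hG : ∀ t u, G (t + T) u = G t u) (h : IsSolOn G w (Ici s))
    (hw : ∀ t, s ≤ t → w (t + T) = w t) :
    ∃ u, IsSolOn G u univ ∧ Function.Periodic u T ∧ ∀ t, s ≤ t → u t = w t := by
  obtain ⟨g, hg, hgG⟩ := h
  set u : ℝ → ℝ := fun t => w (toIcoMod hT s t) with hu
  have huper : Function.Periodic u T := fun t => by simp only [hu, toIcoMod_add_right]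
  have huw : ∀ t, s ≤ t → u t = w t := by
    intro t ht
    obtain ⟨x, hx, n, rfl⟩ := exists_add_nat_mul hT ht
    rw [eq_of_periodic_tail hT hw hx.1 n, ← nsmul_eq_mul]
    simp only [hu]
    rw [toIcoMod_add_nsmul, (toIcoMod_eq_self hT).2 hx]
  have hderper : Function.Periodic (deriv u) T := by
    intro t
    rw [← deriv_comp_add_const]
    congr 1
    exact funext huper
  have hder : ∀ᵐ t, s < t → deriv u t = g t := by
    have hn : ∀ᵐ t, ∀ n : ℕ, t ∈ uIcc s (s + n) → ∀ c ∈ uIcc s (s + n),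
        HasDerivAt (fun x => ∫ y in c..x, g y) (g t) t :=
      ae_all_iff.2 fun n => IntervalIntegrable.ae_hasDerivAt_integral
        (hg s self_mem_Ici (s + n) (mem_Ici.2 (by simp)) (by simp)).1
    filter_upwards [hn] with t ht hst
    obtain ⟨n, hn⟩ := exists_nat_gt (t - s)
    have h1 := ht n (by rw [uIcc_of_le (by simp)]; exact ⟨hst.le, by linarith⟩) s left_mem_uIcc
    refine HasDerivAt.deriv ((h1.const_add (w s)).congr_of_eventuallyEq ?_)
    filter_upwards [Ioi_mem_nhds hst] with x hx
    have hsx : s ≤ x := le_of_lt hx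
    rw [huw x hsx, ← (hg s self_mem_Ici x hsx hsx).2]
    ring
  have hshift : ∀ {f : ℝ → ℝ}, Function.Periodic f T → ∀ (n : ℕ) t, f (t + n * T) = f t :=
    fun hf n t => hf.nat_mul n t
  refine ⟨u, ⟨deriv u, fun a _ b _ hab => ?_, ?_⟩, huper, huw⟩
  · obtain ⟨n, hn⟩ := exists_nat_ge ((s - a) / T)
    rw [div_le_iff₀ hT] at hn
    have ha : s ≤ a + n * T := by linarith
    have hb : s ≤ b + n * T := by linarith
    obtain ⟨i, e⟩ := hg (a + n * T) ha (b + n * T) hb (by linarith)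
    have hae : ∀ᵐ x, x ∈ uIoc (a + n * T) (b + n * T) → g x = deriv u x := by
      filter_upwards [hder] with x hx hmem
      rw [uIoc_of_le (by linarith)] at hmem
      exact (hx (ha.trans_lt hmem.1)).symm
    have i' : IntervalIntegrable (deriv u) volume (a + n * T) (b + n * T) :=
      i.congr_ae ((ae_restrict_iff' measurableSet_uIoc).2 hae)
    have e' := intervalIntegral.integral_congr_ae hae
    have hfun : (fun x => deriv u (x + n * T)) = deriv u := funext (hshift hderper n)
    refine ⟨?_, ?_⟩
    · have := i'.comp_add_right (n * T)
      rw [hfun] at this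
      simpa using this
    · have := intervalIntegral.integral_comp_add_right (a := a) (b := b) (deriv u) (n * T)
      rw [hfun] at this
      rw [this, ← e', ← e, ← huw _ ha, ← huw _ hb, hshift huper, hshift huper]
  · have hP : ∀ᵐ t, s < t → deriv u t ∈ G t (u t) := by
      filter_upwards [hder, hgG] with t h1 h2 hst
      rw [h1 hst, huw t hst.le]
      exact h2 hst.le
    filter_upwards [ae_all_iff.2 fun n : ℕ => ae_comp_add_right hP (n * T)] with t ht _
    obtain ⟨n, hn⟩ := exists_nat_gt ((s - t) / T)
    rw [div_lt_iff₀ hT] at hn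
    have := ht n (by linarith)
    rwa [hshift hderper, hshift huper, rhs_add_nat_mul hG] at this

theorem integrable_of_antitone_of_tendsto {μ : Measure ℝ} {f : ℕ → ℝ → ℝ} {F : ℝ → ℝ} {C : ℝ}
    (hf : ∀ n, Integrable (f n) μ) (hanti : ∀ᵐ x ∂μ, Antitone fun n => f n x)
    (hlim : ∀ᵐ x ∂μ, Tendsto (fun n => f n x) atTop (𝓝 (F x)))
    (hC : ∀ n, C ≤ ∫ x, f n x ∂μ) : Integrable F μ := by
  have key : Integrable (fun x => f 0 x - F x) μ := by
    refine integrable_of_tendsto (G := fun n x => f 0 x - f n x) ?_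
      (fun n => ((hf 0).sub (hf n)).1) ?_
    · filter_upwards [hlim] with x hx using hx.const_sub _
    · have hle : ∀ n, ∫⁻ x, ‖f 0 x - f n x‖ₑ ∂μ ≤ ENNReal.ofReal (∫ x, f 0 x ∂μ - C) := by
        intro n
        refine (ofReal_integral_norm_eq_lintegral_enorm ((hf 0).sub (hf n))).symm.trans_le ?_
        refine ENNReal.ofReal_le_ofReal ?_
        have : ∫ x, ‖(f 0 - f n) x‖ ∂μ = ∫ x, (f 0 x - f n x) ∂μ := by
          refine integral_congr_ae ?_
          filter_upwards [hanti] with x hx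
          exact Real.norm_of_nonneg (sub_nonneg.2 (hx (Nat.zero_le n)))
        rw [this, integral_sub (hf 0) (hf n)]
        linarith [hC n]
      exact ((liminf_le_of_frequently_le' (Frequently.of_forall hle)).trans_lt
        ENNReal.ofReal_lt_top).ne
  have := (hf 0).sub key
  refine this.congr (Eventually.of_forall fun x => ?_)
  simp

/-- A bounded solution that strictly increases over each period converges to a solution that is
periodic on the half-line. -/
theorem OneSidedRegular.exists_limit_of_lt {T : ℝ} (hT : 0 < T) {G : ℝ → ℝ → Set ℝ}
    (hG : OneSidedRegular T G) {v : ℝ → ℝ} {t₀ r : ℝ} (hr : 0 < r) (hv : IsSolOn G v (Ici t₀))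
    (hb : ∀ t, t₀ ≤ t → |v t| ≤ r) (hlt : ∀ t, t₀ ≤ t → v t < v (t + T)) :
    ∃ w, IsSolOn G w (Ici t₀) ∧ (∀ t, t₀ ≤ t → w (t + T) = w t) ∧
      Tendsto (fun t => v t - w t) atTop (𝓝 0) := by
  have hvc := hv.continuousOn
  obtain ⟨L, hL0, hL⟩ := hG.oneSided r hr
  have hstep : ∀ t, t₀ ≤ t → ∀ n : ℕ, t₀ ≤ t + n * T := fun t ht n => by
    have : (0 : ℝ) ≤ n * T := by positivity
    linarith
  have hmono : ∀ t, t₀ ≤ t → StrictMono fun n : ℕ => v (t + n * T) := by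
    intro t ht
    refine strictMono_nat_of_lt_succ fun n => ?_
    have := hlt (t + n * T) (hstep t ht n)
    convert! this using 2
    push_cast
    ring
  set w : ℝ → ℝ := fun t => ⨆ n : ℕ, v (t + n * T)
  have hlim : ∀ t, t₀ ≤ t → Tendsto (fun n : ℕ => v (t + n * T)) atTop (𝓝 (w t)) := by
    intro t ht
    refine tendsto_atTop_ciSup (hmono t ht).monotone ⟨r, ?_⟩
    rintro _ ⟨n, rfl⟩
    exact (abs_le.1 (hb _ (hstep t ht n))).2
  have hwper : ∀ t, t₀ ≤ t → w (t + T) = w t := by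
    intro t ht
    refine tendsto_nhds_unique (hlim (t + T) (by linarith)) ?_
    have := (tendsto_add_atTop_iff_nat 1).2 (hlim t ht)
    convert! this using 3
    push_cast
    ring
  have hwsol : IsSolOn G w (Ici t₀) := by
    obtain ⟨g, hg, hgG⟩ := hv
    have hae : ∀ᵐ t, t₀ ≤ t → ∀ n : ℕ, g (t + n * T) ∈ G t (v (t + n * T)) := by
      filter_upwards [ae_all_iff.2 fun n : ℕ => ae_comp_add_right hgG (n * T)] with t ht h0 n
      have := ht n (hstep t h0 n)
      rwa [rhs_add_nat_mul hG.periodic] at this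
    set q : ℕ → ℝ → ℝ := fun n t => g (t + n * T) - L * v (t + n * T) with hq
    set Q : ℝ → ℝ := fun t => ⨅ n, q n t
    have hanti : ∀ᵐ t, t₀ ≤ t → Antitone fun n => q n t := by
      filter_upwards [hae] with t ht h0
      refine antitone_nat_of_succ_le fun n => ?_
      have := hL t _ _ _ _ (hb _ (hstep t h0 n)) (hb _ (hstep t h0 (n + 1)))
        (hmono t h0 n.lt_succ_self) (ht h0 n) (ht h0 (n + 1))
      simp only [hq]
      linarith
    have hqlim : ∀ᵐ t, t₀ ≤ t → Tendsto (fun n => q n t) atTop (𝓝 (Q t)) := by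
      filter_upwards [hae, hanti] with t ht ha h0
      obtain ⟨M, hM⟩ := hG.bounded r hr t
      refine tendsto_atTop_ciInf (ha h0) ⟨-M - L * r, ?_⟩
      rintro _ ⟨n, rfl⟩
      have h1 := (abs_le.1 (hM _ _ (hb _ (hstep t h0 n)) (ht h0 n))).1
      have h2 := mul_le_mul_of_nonneg_left (abs_le.1 (hb _ (hstep t h0 n))).2 hL0
      simp only [hq]
      linarith
    refine ⟨fun t => Q t + L * w t, fun a ha b hb' hab => ?_, ?_⟩
    · have ha0 : t₀ ≤ a := ha
      have hb0 : t₀ ≤ b := hb'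
      have hsub : ∀ x ∈ uIoc a b, t₀ ≤ x := fun x hx => by
        rw [uIoc_of_le hab] at hx
        exact ha0.trans hx.1.le
      have hvi : ∀ n : ℕ, IntervalIntegrable (fun t => v (t + n * T)) volume a b := by
        intro n
        refine ContinuousOn.intervalIntegrable (hvc.comp (by fun_prop) fun x hx => ?_)
        rw [uIcc_of_le hab] at hx
        exact hstep x (ha0.trans hx.1) n
      have hgi : ∀ n : ℕ, IntervalIntegrable (fun t => g (t + n * T)) volume a b ∧
          ∫ t in a..b, g (t + n * T) = v (b + n * T) - v (a + n * T) := by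
        intro n
        obtain ⟨i, e⟩ := hg _ (hstep a ha0 n) _ (hstep b hb0 n) (by linarith)
        refine ⟨by simpa using i.comp_add_right (n * T), ?_⟩
        rw [intervalIntegral.integral_comp_add_right, e]
      have hwi : IntervalIntegrable w volume a b := by
        refine (intervalIntegrable_const (c := r)).mono_fun' ?_ ?_
        · refine aestronglyMeasurable_of_tendsto_ae (f := fun (n : ℕ) t => v (t + n * T)) atTop
            (fun n => (hvi n).aestronglyMeasurable_restrict_uIoc) ?_
          exact (ae_restrict_iff' measurableSet_uIoc).2
            (Eventually.of_forall fun x hx => hlim x (hsub x hx))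
        · refine (ae_restrict_iff' measurableSet_uIoc).2 (Eventually.of_forall fun x hx => ?_)
          exact le_of_tendsto' (hlim x (hsub x hx)).norm
            fun n => hb _ (hstep x (hsub x hx) n)
      have hwlim : Tendsto (fun n : ℕ => ∫ t in a..b, v (t + n * T)) atTop
          (𝓝 (∫ t in a..b, w t)) := by
        refine intervalIntegral.tendsto_integral_filter_of_dominated_convergence (fun _ => r)
          (Eventually.of_forall fun n => (hvi n).aestronglyMeasurable_restrict_uIoc)
          (Eventually.of_forall fun n => Eventually.of_forall fun x hx =>
            hb _ (hstep x (hsub x hx) n)) intervalIntegrable_const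
          (Eventually.of_forall fun x hx => hlim x (hsub x hx))
      have hqi : ∀ n, IntervalIntegrable (q n) volume a b := fun n =>
        (hgi n).1.sub ((hvi n).const_mul L)
      have hqint : ∀ n : ℕ, ∫ t in a..b, q n t =
          v (b + n * T) - v (a + n * T) - L * ∫ t in a..b, v (t + n * T) := by
        intro n
        simp only [hq]
        rw [intervalIntegral.integral_sub (hgi n).1 ((hvi n).const_mul L), (hgi n).2,
          intervalIntegral.integral_const_mul]
      have hqtend : Tendsto (fun n => ∫ t in a..b, q n t) atTop
          (𝓝 (w b - w a - L * ∫ t in a..b, w t)) := by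
        simp only [hqint]
        exact ((hlim b hb0).sub (hlim a ha0)).sub (hwlim.const_mul L)
      obtain ⟨C, hC⟩ := hqtend.bddBelow_range
      simp only [intervalIntegral.integral_of_le hab] at hqtend hC
      have hres : ∀ {P : ℝ → Prop}, (∀ᵐ t, t₀ ≤ t → P t) →
          ∀ᵐ t ∂(volume.restrict (Ioc a b)), P t := by
        intro P hP
        refine (ae_restrict_iff' measurableSet_Ioc).2 ?_
        filter_upwards [hP] with t ht hmem using ht (ha0.trans hmem.1.le)
      have hqI : ∀ n, Integrable (q n) (volume.restrict (Ioc a b)) := fun n => (hqi n).1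
      have hQI : Integrable Q (volume.restrict (Ioc a b)) :=
        integrable_of_antitone_of_tendsto hqI (hres hanti) (hres hqlim)
          fun n => hC (mem_range_self n)
      have hQint := tendsto_nhds_unique hqtend
        (integral_tendsto_of_tendsto_of_antitone hqI hQI (hres hanti) (hres hqlim))
      have hQi : IntervalIntegrable Q volume a b :=
        (intervalIntegrable_iff_integrableOn_Ioc_of_le hab).2 hQI
      refine ⟨hQi.add (hwi.const_mul L), ?_⟩
      rw [intervalIntegral.integral_add hQi (hwi.const_mul L),
        intervalIntegral.integral_const_mul, intervalIntegral.integral_of_le hab (f := Q),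
        ← hQint, intervalIntegral.integral_of_le hab]
      ring
    · filter_upwards [hae, hqlim] with t ht hl h0
      refine hG.closed t _ (fun n : ℕ => g (t + n * T)) _ _ (hlim t h0) ?_ (ht h0)
      have := (hl h0).add ((hlim t h0).const_mul L)
      simpa [hq] using this
  refine ⟨w, hwsol, hwper, ?_⟩
  have huni : TendstoUniformlyOn (fun (n : ℕ) t => v (t + n * T)) w atTop (Icc t₀ (t₀ + T)) := by
    refine Monotone.tendstoUniformlyOn_of_forall_tendsto isCompact_Icc (fun n => ?_)
      (fun x hx => (hmono x hx.1).monotone) (hwsol.continuousOn.mono Icc_subset_Ici_self)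
      fun x hx => hlim x hx.1
    exact hvc.comp (by fun_prop) fun x hx => hstep x hx.1 n
  rw [Metric.tendstoUniformlyOn_iff] at huni
  rw [Metric.tendsto_atTop]
  intro ε hε
  obtain ⟨N, hN⟩ := eventually_atTop.1 (huni ε hε)
  refine ⟨t₀ + N * T, fun t ht => ?_⟩
  have hNT : (0 : ℝ) ≤ N * T := by positivity
  obtain ⟨x, hx, n, rfl⟩ := exists_add_nat_mul hT (show t₀ ≤ t by linarith)
  have hn : N ≤ n := by
    have h1 : (N : ℝ) * T < (n + 1) * T := by linarith [hx.2]
    have h2 : (N : ℝ) < n + 1 := lt_of_mul_lt_mul_right h1 hT.le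
    exact Nat.lt_succ_iff.1 (by exact_mod_cast h2)
  have := hN n hn x ⟨hx.1, hx.2.le⟩
  rw [eq_of_periodic_tail hT hwper hx.1 n, Real.dist_eq, sub_zero, abs_sub_comm]
  rwa [Real.dist_eq] at this

/-- Every bounded solution is asymptotic to a solution that is periodic on a half-line. -/
theorem OneSidedRegular.exists_asymptotic_periodic {T : ℝ} (hT : 0 < T) {G : ℝ → ℝ → Set ℝ}
    (hG : OneSidedRegular T G) {v : ℝ → ℝ} {t₀ r : ℝ} (hr : 0 < r) (hv : IsSolOn G v (Ici t₀))
    (hb : ∀ t, t₀ ≤ t → |v t| ≤ r) :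
    ∃ s w, IsSolOn G w (Ici s) ∧ (∀ t, s ≤ t → w (t + T) = w t) ∧
      Tendsto (fun t => v t - w t) atTop (𝓝 0) := by
  have hvT : IsSolOn G (fun t => v (t + T)) (Ici t₀) := hv.shift hT hG.periodic
  by_cases hex : ∃ s, t₀ ≤ s ∧ v (s + T) = v s
  · obtain ⟨s, hs, he⟩ := hex
    have hsub : Ici s ⊆ Ici t₀ := Ici_subset_Ici.2 hs
    have hbs : ∀ t, s ≤ t → |v t| ≤ r := fun t ht => hb t (hs.trans ht)
    have hbT : ∀ t, s ≤ t → |v (t + T)| ≤ r := fun t ht => hb _ (by linarith)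
    refine ⟨s, v, hv.mono hsub, fun t ht => ?_, by simp⟩
    exact le_antisymm
      (hG.le_of_le hr (hvT.mono hsub) (hv.mono hsub) hbT hbs he.le ht)
      (hG.le_of_le hr (hv.mono hsub) (hvT.mono hsub) hbs hbT he.ge ht)
  · push Not at hex
    have hcont : ContinuousOn (fun t => v (t + T) - v t) (Ici t₀) :=
      hvT.continuousOn.sub hv.continuousOn
    have hsign : (∀ t, t₀ ≤ t → v t < v (t + T)) ∨ ∀ t, t₀ ≤ t → v (t + T) < v t := by
      by_contra! hcon
      obtain ⟨⟨x, hx, hx'⟩, ⟨y, hy, hy'⟩⟩ := hcon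
      obtain ⟨z, hz, hz'⟩ := isPreconnected_Ici.intermediate_value (mem_Ici.2 hx) (mem_Ici.2 hy)
        hcont (show (0 : ℝ) ∈ Icc _ _ from ⟨sub_nonpos.2 hx', sub_nonneg.2 hy'⟩)
      exact hex z hz (sub_eq_zero.1 hz')
    rcases hsign with h | h
    · obtain ⟨w, hw⟩ := hG.exists_limit_of_lt hT hr hv hb h
      exact ⟨t₀, w, hw⟩
    · obtain ⟨w, hw, hwper, hlim⟩ := hG.reflect.exists_limit_of_lt hT hr hv.reflect
        (fun t ht => by simpa using hb t ht) (fun t ht => neg_lt_neg (h t ht))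
      refine ⟨t₀, fun t => -w t, ?_, fun t ht => congrArg Neg.neg (hwper t ht), ?_⟩
      · have hGG : reflectRHS (reflectRHS G) = G := by
          funext t u
          simp [reflectRHS]
        have := hw.reflect
        rwa [hGG] at this
      · have := hlim.neg
        simp only [neg_zero] at this
        refine this.congr fun t => ?_
        ring

/-- Under (S1) and (S2), if `v̇ ∈ G(t,v)` admits exactly one `T`-periodic
solution `v*`, then `v*` is a global attractor: every solution `v` on `[t₀,∞)` satisfies
`v(t) - v*(t) → 0` as `t → ∞`. -/
theorem unique_periodic_is_global_attractor (T : ℝ) (hT : 0 < T) (G : ℝ → ℝ → Set ℝ)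
    (hS1 : SatS1 T G) (hS2 : SatS2 T G)
    (vstar : ℝ → ℝ)
    (hsol : IsSolOn G vstar Set.univ) (hper : Function.Periodic vstar T)
    (huniq : ∀ u : ℝ → ℝ, IsSolOn G u Set.univ → Function.Periodic u T → u = vstar)
    (t₀ : ℝ) (v : ℝ → ℝ) (hv : IsSolOn G v (Set.Ici t₀)) :
    Tendsto (fun t => v t - vstar t) atTop (𝓝 0) := by
  have hG := hS1.oneSidedRegular
  obtain ⟨r, hr, hb⟩ := hv.exists_abs_bound hT hS2
  obtain ⟨s, w, hw, hwper, hlim⟩ := hG.exists_asymptotic_periodic hT hr hv hb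
  obtain ⟨u, hu, huper, huw⟩ := hw.exists_periodic_extension hT hG.periodic hwper
  rw [huniq u hu huper] at huw
  refine hlim.congr' ?_
  filter_upwards [eventually_ge_atTop s] with t ht
  rw [huw t ht]
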